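/- arXiv:2011.03662 — 2 statements merged into one kernel-verified Lean document; each statement's English description precedes it below -/
import Mathlib

section
/- Let N : (ℝ⁶)³ → ℝ be trilinear, antisymmetric in its last two arguments, and of type (0,2) with respect to J, i.e. N(Jx, y, z) = N(x, Jy, z) = N(x, y, Jz) for all x, y, z, and let φ be a 3-form on ℝ⁶ satisfying φ(Jx, Jy, z) = −φ(x, y, z) for all x, y, z. If N⊠φ = 0, then Σ_{p=1}^{6} ( N(e_p, x, y)·φ(e_p, z, w) + N(e_p, z, w)·φ(e_p, x, y) ) = 0 for all x, y, z, w ∈ ℝ⁶. -/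
noncomputable section

/-- The underlying vector space `ℝ⁶`. -/
abbrev V6 : Type := Fin 6 → ℝ

/-- The standard basis of `ℝ⁶`. -/
def e6 (i : Fin 6) : V6 := fun j => if j = i then (1 : ℝ) else 0

/-- The standard complex structure `J` with `Je₁=e₂, Je₂=−e₁, Je₃=e₄, Je₄=−e₃, Je₅=e₆,
Je₆=−e₅`. -/
def Jstd (x : V6) : V6 := ![-x 1, x 0, -x 3, x 2, -x 5, x 4]

/-- For a trilinear map `T` antisymmetric in its last two arguments and a 3-form `μ`,
the quadrilinear map `T ⊠ μ` (indices raised with the standard Euclidean metric). -/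
def boxt (T μ : V6 → V6 → V6 → ℝ) (x y z w : V6) : ℝ :=
  ∑ p : Fin 6,
    (T (e6 p) x y * μ (e6 p) z w + T (e6 p) z w * μ (e6 p) x y
      - T (e6 p) x z * μ (e6 p) y w - T (e6 p) y w * μ (e6 p) x z
      + T (e6 p) x w * μ (e6 p) y z + T (e6 p) y z * μ (e6 p) x w)

/-- A 3-form, viewed as a trilinear function of vectors. -/
def ap3 (φ : AlternatingMap ℝ V6 ℝ (Fin 3)) : V6 → V6 → V6 → ℝ :=
  fun x y z => φ ![x, y, z]

theorem Jstd_Jstd (x : V6) : Jstd (Jstd x) = -x := by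
  funext i
  fin_cases i <;> simp [Jstd]

/-- The standard complex structure is skew-adjoint for the Euclidean metric. -/
theorem sum_Jstd_mul (f g : V6 → ℝ) (hf : ∀ x, f (-x) = -f x) (hg : ∀ x, g (-x) = -g x) :
    ∑ p : Fin 6, f (Jstd (e6 p)) * g (e6 p) = -∑ p : Fin 6, f (e6 p) * g (Jstd (e6 p)) := by
  have h0 : Jstd (e6 0) = e6 1 := by funext i; fin_cases i <;> simp [Jstd, e6]
  have h1 : Jstd (e6 1) = -e6 0 := by funext i; fin_cases i <;> simp [Jstd, e6]
  have h2 : Jstd (e6 2) = e6 3 := by funext i; fin_cases i <;> simp [Jstd, e6]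
  have h3 : Jstd (e6 3) = -e6 2 := by funext i; fin_cases i <;> simp [Jstd, e6]
  have h4 : Jstd (e6 4) = e6 5 := by funext i; fin_cases i <;> simp [Jstd, e6]
  have h5 : Jstd (e6 5) = -e6 4 := by funext i; fin_cases i <;> simp [Jstd, e6]
  simp only [Fin.sum_univ_six, h0, h1, h2, h3, h4, h5, hf, hg]
  ring

theorem ap3_neg_left (φ : AlternatingMap ℝ V6 ℝ (Fin 3)) (x y z : V6) :
    ap3 φ (-x) y z = -ap3 φ x y z := by
  have h := φ.map_update_neg ![x, y, z] 0 x
  rw [show Function.update ![x, y, z] 0 (-x) = ![-x, y, z] by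
      funext i; fin_cases i <;> rfl,
    show Function.update ![x, y, z] 0 x = ![x, y, z] by
      funext i; fin_cases i <;> rfl] at h
  exact h

theorem ap3_swap_left (φ : AlternatingMap ℝ V6 ℝ (Fin 3)) (x y z : V6) :
    ap3 φ y x z = -ap3 φ x y z := by
  have h := φ.map_swap ![x, y, z] (i := 0) (j := 1) (by decide)
  rw [← show (![y, x, z] : Fin 3 → V6) = ![x, y, z] ∘ Equiv.swap 0 1 by
    funext i; fin_cases i <;> rfl] at h
  exact h

theorem ap3_swap_right (φ : AlternatingMap ℝ V6 ℝ (Fin 3)) (x y z : V6) :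
    ap3 φ x z y = -ap3 φ x y z := by
  have h := φ.map_swap ![x, y, z] (i := 1) (j := 2) (by decide)
  rw [← show (![x, z, y] : Fin 3 → V6) = ![x, y, z] ∘ Equiv.swap 1 2 by
    funext i; fin_cases i <;> rfl] at h
  exact h

/-- The metric contraction of `T` and `μ` in their first arguments. -/
def contr (T μ : V6 → V6 → V6 → ℝ) (x y z w : V6) : ℝ :=
  ∑ p : Fin 6, T (e6 p) x y * μ (e6 p) z w

theorem boxt_eq_contr (T μ : V6 → V6 → V6 → ℝ) (x y z w : V6) :
    boxt T μ x y z w = contr T μ x y z w + contr T μ z w x y - contr T μ x z y w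
      - contr T μ y w x z + contr T μ x w y z + contr T μ y z x w := by
  simp only [boxt, contr, Finset.sum_add_distrib, Finset.sum_sub_distrib]

/-- With `N` and φ as in Statement 5, if `N ⊠ φ = 0` then
`Σ_p ( N(e_p,x,y)·φ(e_p,z,w) + N(e_p,z,w)·φ(e_p,x,y) ) = 0` for all `x, y, z, w`. -/
theorem boxtimes_zero_switch_identity (N : V6 →ₗ[ℝ] V6 →ₗ[ℝ] V6 →ₗ[ℝ] ℝ)
    (hanti : ∀ x y z : V6, N x y z = -N x z y)
    (htype1 : ∀ x y z : V6, N (Jstd x) y z = N x (Jstd y) z)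
    (htype2 : ∀ x y z : V6, N x (Jstd y) z = N x y (Jstd z))
    (φ : AlternatingMap ℝ V6 ℝ (Fin 3))
    (hφ : ∀ x y z : V6, φ ![Jstd x, Jstd y, z] = -φ ![x, y, z])
    (hbox : ∀ x y z w : V6, boxt (fun a b c => N a b c) (ap3 φ) x y z w = 0) :
    ∀ x y z w : V6,
      (∑ p : Fin 6, (N (e6 p) x y * φ ![e6 p, z, w] + N (e6 p) z w * φ ![e6 p, x, y])) = 0 := by
  have hpair : ∀ x y z, ap3 φ x (Jstd y) (Jstd z) = -ap3 φ x y z := fun x y z => by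
    have h : ap3 φ (Jstd y) (Jstd z) x = -ap3 φ y z x := hφ y z x
    rw [ap3_swap_left, ap3_swap_right, neg_neg, h, ap3_swap_right, ap3_swap_left]
    ring
  have hmove : ∀ x y z, ap3 φ (Jstd x) y z = ap3 φ x (Jstd y) z := fun x y z => by
    have h : ap3 φ (Jstd (Jstd x)) (Jstd y) z = -ap3 φ (Jstd x) y z := hφ (Jstd x) y z
    rw [Jstd_Jstd, ap3_neg_left] at h
    linarith
  set S := contr (fun a b c => N a b c) (ap3 φ) with hS
  have hleft : ∀ x y z w, S (Jstd x) (Jstd y) z w = -S x y z w := fun x y z w => by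
    simp [hS, contr, htype2, Jstd_Jstd]
  have hright : ∀ x y z w, S z w (Jstd x) (Jstd y) = -S z w x y := fun x y z w => by
    simp [hS, contr, hpair]
  have hmix : ∀ x y z w, S (Jstd x) y (Jstd z) w = S x y z w := fun x y z w => by
    have h := sum_Jstd_mul (fun p => N p x y) (fun p => ap3 φ p (Jstd z) w)
      (fun p => by simp) (fun p => ap3_neg_left φ p _ _)
    simp only [htype1, hmove, Jstd_Jstd] at h
    have hneg : ∀ p, ap3 φ p (-z) w = -ap3 φ p z w := fun p => by
      rw [ap3_swap_left, ap3_neg_left, neg_neg, ap3_swap_left]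
    simpa [hS, contr, hneg] using h
  intro x y z w
  have h₁ := hbox x y z w
  have h₂ := hbox (Jstd x) (Jstd y) z w
  rw [boxt_eq_contr, ← hS] at h₁ h₂
  rw [hleft, hright, hmix, hmix, hmix, hmix] at h₂
  rw [Finset.sum_add_distrib]
  change S x y z w + S z w x y = 0
  linarith
end
end

section
/- Let φ be a 3-form on ℝ⁶ with ω ∧ φ = 0, let ν be a 1-form on ℝ⁶, and set λ := ν ∧ ω. Then for all i, j ∈ {1,…,6}: Σ_{a,b,c,d} ω^{ac} ω^{bd} ( φ(e_i,e_a,e_b)·λ(e_j,e_c,e_d) + λ(e_i,e_a,e_b)·φ(e_j,e_c,e_d) ) = 0, where (ω^{ij}) denotes the inverse of the matrix (ω_{ij}) := (ω(e_i,e_j)). -/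
noncomputable section

/-- The standard symplectic form `ω = e¹∧e² + e³∧e⁴ + e⁵∧e⁶`. -/
def ω6 (x y : V6) : ℝ :=
  x 0 * y 1 - x 1 * y 0 + x 2 * y 3 - x 3 * y 2 + x 4 * y 5 - x 5 * y 4

/-- Wedge product of a 2-form and a 3-form (standard convention `1/(2!·3!)`). -/
def wedge23 (a : V6 → V6 → ℝ) (b : V6 → V6 → V6 → ℝ) (v : Fin 5 → V6) : ℝ :=
  (1 / 12 : ℝ) * ∑ σ : Equiv.Perm (Fin 5),
    ((Equiv.Perm.sign σ : ℤ) : ℝ) *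
      (a (v (σ 0)) (v (σ 1)) * b (v (σ 2)) (v (σ 3)) (v (σ 4)))

/-- The matrix `(ω_{ij}) = (ω(e_i, e_j))` of the standard symplectic form. -/
def Ωmat : Matrix (Fin 6) (Fin 6) ℝ := Matrix.of fun i j => ω6 (e6 i) (e6 j)

/-- The 3-form `λ = ν ∧ ω`, as a trilinear function. -/
def nuWedgeOmega (ν : V6 →ₗ[ℝ] ℝ) (x y z : V6) : ℝ :=
  ν x * ω6 y z - ν y * ω6 x z + ν z * ω6 x y

/-- The index of the basis vector which is symplectically dual to `e6 i`, up to sign. -/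
def dualIndex : Fin 6 → Fin 6 := ![1, 0, 3, 2, 5, 4]

/-- The sign `ω6 (e6 i) (e6 (dualIndex i))`. -/
def dualSign : Fin 6 → ℝ := ![1, -1, 1, -1, 1, -1]

lemma dualIndex_dualIndex (i : Fin 6) : dualIndex (dualIndex i) = i := by
  revert i; decide

lemma dualSign_dualIndex (i : Fin 6) : dualSign (dualIndex i) = -dualSign i := by
  fin_cases i <;> simp [dualSign, dualIndex]

lemma dualSign_mul_self (i : Fin 6) : dualSign i * dualSign i = 1 := by
  fin_cases i <;> simp [dualSign]

lemma ω6_e6 (i j : Fin 6) :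
    ω6 (e6 i) (e6 j) = if j = dualIndex i then dualSign i else 0 := by
  fin_cases i <;> fin_cases j <;> simp [ω6, e6, dualIndex, dualSign]

lemma Ωmat_inv_apply (i j : Fin 6) :
    Ωmat⁻¹ i j = if j = dualIndex i then -dualSign i else 0 := by
  have h : Ωmat⁻¹ = -Ωmat := by
    refine Matrix.inv_eq_right_inv ?_
    ext a c
    simp only [Matrix.mul_apply, Matrix.neg_apply, Ωmat, Matrix.of_apply, ω6_e6, ite_mul,
      zero_mul, Finset.sum_ite_eq', Finset.mem_univ, if_true,
      dualIndex_dualIndex, dualSign_dualIndex, Matrix.one_apply, eq_comm (a := c)]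
    split_ifs <;> simp [dualSign_mul_self]
  rw [h, Matrix.neg_apply, Ωmat, Matrix.of_apply, ω6_e6]
  split_ifs <;> simp

lemma ω6_swap (x y : V6) : ω6 y x = -ω6 x y := by
  unfold ω6; ring

lemma alternating_swap_right (φ : AlternatingMap ℝ V6 ℝ (Fin 3)) (x y z : V6) :
    φ ![x, z, y] = -φ ![x, y, z] := by
  rw [← φ.map_swap ![x, y, z] (i := 1) (j := 2) (by decide)]
  congr 1
  ext i; fin_cases i <;> rfl

lemma alternating_swap_left (φ : AlternatingMap ℝ V6 ℝ (Fin 3)) (x y z : V6) :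
    φ ![y, x, z] = -φ ![x, y, z] := by
  rw [← φ.map_swap ![x, y, z] (i := 0) (j := 1) (by decide)]
  congr 1
  ext i; fin_cases i <;> rfl

lemma sum_perm_fin_succ {n : ℕ} (f : Equiv.Perm (Fin (n + 1)) → ℝ) :
    ∑ σ, f σ = ∑ p : Fin (n + 1), ∑ τ : Equiv.Perm (Fin n),
      f (Equiv.Perm.decomposeFin.symm (p, τ)) := by
  rw [← Fintype.sum_prod_type', ← Equiv.sum_comp Equiv.Perm.decomposeFin.symm]

/-- Evaluation of `ω ∧ φ` on a vector together with two orthogonal symplectic pairs. -/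
lemma wedge23_symplectic_pairs (φ : AlternatingMap ℝ V6 ℝ (Fin 3)) {x p q r s : V6}
    (hxp : ω6 x p = 0) (hxq : ω6 x q = 0) (hxr : ω6 x r = 0) (hxs : ω6 x s = 0)
    (hpq : ω6 p q = 1) (hpr : ω6 p r = 0) (hps : ω6 p s = 0)
    (hqr : ω6 q r = 0) (hqs : ω6 q s = 0) (hrs : ω6 r s = 1) :
    wedge23 ω6 (ap3 φ) ![x, p, q, r, s] = φ ![x, p, q] + φ ![x, r, s] := by
  have hpx := ω6_swap x p
  have hqx := ω6_swap x q
  have hrx := ω6_swap x r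
  have hsx := ω6_swap x s
  have hqp := ω6_swap p q
  have hrp := ω6_swap p r
  have hsp := ω6_swap p s
  have hrq := ω6_swap q r
  have hsq := ω6_swap q s
  have hsr := ω6_swap r s
  simp only [hxp, hxq, hxr, hxs, hpq, hpr, hps, hqr, hqs, hrs, neg_zero]
    at hpx hqx hrx hsx hqp hrp hsp hrq hsq hsr
  have e1 := alternating_swap_right φ x p q
  have e2 := alternating_swap_left φ x p q
  have e3 := alternating_swap_left φ x q p
  have e4 := alternating_swap_right φ p x q
  have e5 := alternating_swap_right φ q x p
  have f1 := alternating_swap_right φ x r s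
  have f2 := alternating_swap_left φ x r s
  have f3 := alternating_swap_left φ x s r
  have f4 := alternating_swap_right φ r x s
  have f5 := alternating_swap_right φ s x r
  simp only [e1, e2, f1, f2] at e3 e4 e5 f3 f4 f5
  simp only [e3, f3] at e5 f5
  have sum_perm_five (f : Equiv.Perm (Fin 5) → ℝ) : ∑ σ, f σ =
      ∑ a : Fin 5, ∑ τ : Equiv.Perm (Fin 4), f (Equiv.Perm.decomposeFin.symm (a, τ)) :=
    sum_perm_fin_succ f
  have sum_perm_four (f : Equiv.Perm (Fin 4) → ℝ) : ∑ σ, f σ =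
      ∑ a : Fin 4, ∑ τ : Equiv.Perm (Fin 3), f (Equiv.Perm.decomposeFin.symm (a, τ)) :=
    sum_perm_fin_succ f
  have sum_perm_three (f : Equiv.Perm (Fin 3) → ℝ) : ∑ σ, f σ =
      ∑ a : Fin 3, ∑ τ : Equiv.Perm (Fin 2), f (Equiv.Perm.decomposeFin.symm (a, τ)) :=
    sum_perm_fin_succ f
  have sum_perm_two (f : Equiv.Perm (Fin 2) → ℝ) : ∑ σ, f σ =
      ∑ a : Fin 2, ∑ τ : Equiv.Perm (Fin 1), f (Equiv.Perm.decomposeFin.symm (a, τ)) :=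
    sum_perm_fin_succ f
  unfold wedge23 ap3
  have d2 {n : ℕ} (a : Fin (n + 3)) (τ : Equiv.Perm (Fin (n + 2))) :
      Equiv.Perm.decomposeFin.symm (a, τ) 2 = Equiv.swap 0 a (τ 1).succ :=
    Equiv.Perm.decomposeFin_symm_apply_succ τ a 1
  have d3 {n : ℕ} (a : Fin (n + 4)) (τ : Equiv.Perm (Fin (n + 3))) :
      Equiv.Perm.decomposeFin.symm (a, τ) 3 = Equiv.swap 0 a (τ 2).succ :=
    Equiv.Perm.decomposeFin_symm_apply_succ τ a 2
  have d4 (a : Fin 5) (τ : Equiv.Perm (Fin 4)) :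
      Equiv.Perm.decomposeFin.symm (a, τ) 4 = Equiv.swap 0 a (τ 3).succ :=
    Equiv.Perm.decomposeFin_symm_apply_succ τ a 3
  simp only [sum_perm_five, sum_perm_four, sum_perm_three, sum_perm_two,
    Fin.sum_univ_five, Fin.sum_univ_four, Fin.sum_univ_three,
    Fin.sum_univ_two, Finset.univ_unique, Finset.sum_singleton,
    Equiv.Perm.decomposeFin.symm_sign, Equiv.Perm.decomposeFin_symm_apply_zero,
    Equiv.Perm.decomposeFin_symm_apply_one, d2, d3, d4, Equiv.swap_self, Equiv.refl_apply]
  simp [Equiv.swap_apply_def, hxp, hxq, hxr, hxs, hpq, hpr, hps, hqr, hqs, hrs,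
    hpx, hqx, hrx, hsx, hqp, hrp, hsp, hrq, hsq, hsr, e1, e2, e3, e4, e5, f1, f2, f3, f4, f5]
  ring

lemma trace_eq_zero (φ : AlternatingMap ℝ V6 ℝ (Fin 3))
    (hprim : ∀ v : Fin 5 → V6, wedge23 ω6 (ap3 φ) v = 0) (i : Fin 6) :
    ∑ a, dualSign a * φ ![e6 i, e6 a, e6 (dualIndex a)] = 0 := by
  have key : ∀ p r : Fin 6, i ≠ p → i ≠ dualIndex p → i ≠ r → i ≠ dualIndex r → p ≠ r →
      p ≠ dualIndex r → dualSign p = 1 → dualSign r = 1 →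
      φ ![e6 i, e6 p, e6 (dualIndex p)] + φ ![e6 i, e6 r, e6 (dualIndex r)] = 0 := by
    intro p r h1 h2 h3 h4 h5 h6 hp hr
    have hd : ∀ {a b : Fin 6}, a ≠ dualIndex b → b ≠ dualIndex a := by decide
    have hd' : ∀ {a b : Fin 6}, a ≠ b → dualIndex b ≠ dualIndex a := by decide
    rw [← wedge23_symplectic_pairs φ, hprim] <;>
      simp [ω6_e6, dualIndex_dualIndex, hp, hr, hd h2, hd h4, hd h6, hd' h1, hd' h3, hd' h5,
        h5.symm, h6.symm]
  have hzero : ∀ y, φ ![e6 i, e6 i, y] = 0 := fun y => by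
    linarith [alternating_swap_left φ (e6 i) (e6 i) y]
  have hzero' : ∀ y, φ ![e6 i, y, e6 i] = 0 := fun y => by
    rw [alternating_swap_right, hzero, neg_zero]
  have k1 := key 0 2
  have k2 := key 0 4
  have k3 := key 2 4
  have s1 := alternating_swap_right φ (e6 i) (e6 0) (e6 1)
  have s2 := alternating_swap_right φ (e6 i) (e6 2) (e6 3)
  have s3 := alternating_swap_right φ (e6 i) (e6 4) (e6 5)
  rw [Fin.sum_univ_six]
  fin_cases i <;> simp [dualIndex, dualSign] at * <;> simp_all <;> linarith

lemma contraction_eq (φ : AlternatingMap ℝ V6 ℝ (Fin 3))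
    (hprim : ∀ v : Fin 5 → V6, wedge23 ω6 (ap3 φ) v = 0) (ν : V6 →ₗ[ℝ] ℝ) (i j : Fin 6) :
    ∑ a, ∑ b, dualSign a * dualSign b *
        (φ ![e6 i, e6 a, e6 b] * nuWedgeOmega ν (e6 j) (e6 (dualIndex a)) (e6 (dualIndex b))) =
      2 * ∑ a, dualSign a * ν (e6 (dualIndex a)) * φ ![e6 i, e6 j, e6 a] := by
  have hW (a b : Fin 6) : ω6 (e6 a) (e6 (dualIndex b)) = if b = a then dualSign a else 0 := by
    have : dualIndex b = dualIndex a ↔ b = a := by revert a b; decide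
    simp only [ω6_e6, this]
  have h1 : ∑ a, ∑ b, dualSign a * dualSign b * (φ ![e6 i, e6 a, e6 b] *
      (ν (e6 j) * ω6 (e6 (dualIndex a)) (e6 (dualIndex b)))) = 0 := by
    rw [← mul_zero (ν (e6 j)), ← trace_eq_zero φ hprim i, Finset.mul_sum]
    refine Finset.sum_congr rfl fun a _ => ?_
    simp only [hW, mul_ite, mul_zero, Finset.sum_ite_eq', Finset.mem_univ, if_true,
      dualSign_dualIndex]
    linear_combination dualSign a * φ ![e6 i, e6 a, e6 (dualIndex a)] * ν (e6 j) *
      dualSign_mul_self a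
  have h2 : ∑ a, ∑ b, dualSign a * dualSign b * (φ ![e6 i, e6 a, e6 b] *
      (ν (e6 (dualIndex a)) * ω6 (e6 j) (e6 (dualIndex b)))) =
      -∑ a, dualSign a * ν (e6 (dualIndex a)) * φ ![e6 i, e6 j, e6 a] := by
    rw [← Finset.sum_neg_distrib]
    refine Finset.sum_congr rfl fun a _ => ?_
    simp only [hW, mul_ite, mul_zero, Finset.sum_ite_eq', Finset.mem_univ, if_true]
    rw [alternating_swap_right φ _ (e6 j)]
    linear_combination -dualSign a * φ ![e6 i, e6 j, e6 a] * ν (e6 (dualIndex a)) *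
      dualSign_mul_self j
  have h3 : ∑ a, ∑ b, dualSign a * dualSign b * (φ ![e6 i, e6 a, e6 b] *
      (ν (e6 (dualIndex b)) * ω6 (e6 j) (e6 (dualIndex a)))) =
      ∑ a, dualSign a * ν (e6 (dualIndex a)) * φ ![e6 i, e6 j, e6 a] := by
    rw [Finset.sum_comm]
    refine Finset.sum_congr rfl fun b _ => ?_
    simp only [hW, mul_ite, mul_zero, Finset.sum_ite_eq', Finset.mem_univ, if_true]
    linear_combination dualSign b * φ ![e6 i, e6 j, e6 b] * ν (e6 (dualIndex b)) *
      dualSign_mul_self j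
  simp only [nuWedgeOmega, mul_add, mul_sub, Finset.sum_add_distrib, Finset.sum_sub_distrib,
    h1, h2, h3]
  ring

/-- For a primitive 3-form φ and `λ := ν ∧ ω`, the `ω⁻¹`-double-contraction
of the symmetrization of `φ ⊗ λ` vanishes: `Σ ω^{ac} ω^{bd}(φ_{iab} λ_{jcd} + λ_{iab} φ_{jcd})
= 0`. -/
theorem contraction_with_nu_wedge_omega (φ : AlternatingMap ℝ V6 ℝ (Fin 3))
    (hprim : ∀ v : Fin 5 → V6, wedge23 ω6 (ap3 φ) v = 0)
    (ν : V6 →ₗ[ℝ] ℝ) :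
    ∀ i j : Fin 6,
      (∑ a : Fin 6, ∑ b : Fin 6, ∑ c : Fin 6, ∑ d : Fin 6,
        Ωmat⁻¹ a c * Ωmat⁻¹ b d *
          (φ ![e6 i, e6 a, e6 b] * nuWedgeOmega ν (e6 j) (e6 c) (e6 d)
            + nuWedgeOmega ν (e6 i) (e6 a) (e6 b) * φ ![e6 j, e6 c, e6 d])) = 0 := by
  intro i j
  have hcollapse (f : Fin 6 → Fin 6 → Fin 6 → Fin 6 → ℝ) :
      ∑ a, ∑ b, ∑ c, ∑ d, Ωmat⁻¹ a c * Ωmat⁻¹ b d * f a b c d =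
        ∑ a, ∑ b, dualSign a * dualSign b * f a b (dualIndex a) (dualIndex b) := by
    simp only [Ωmat_inv_apply, mul_ite, ite_mul, mul_zero, zero_mul, Finset.sum_ite_eq',
      Finset.mem_univ, if_true, neg_mul_neg]
  have hswap (f : Fin 6 → Fin 6 → Fin 6 → Fin 6 → ℝ) :
      ∑ a, ∑ b, dualSign a * dualSign b * f a b (dualIndex a) (dualIndex b) =
        ∑ a, ∑ b, dualSign a * dualSign b * f (dualIndex a) (dualIndex b) a b := by
    let J : Equiv.Perm (Fin 6) := ⟨dualIndex, dualIndex, dualIndex_dualIndex, dualIndex_dualIndex⟩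
    rw [← Equiv.sum_comp J]
    refine Finset.sum_congr rfl fun a _ => ?_
    rw [← Equiv.sum_comp J]
    simp [J, dualIndex_dualIndex, dualSign_dualIndex]
  rw [hcollapse fun a b c d => φ ![e6 i, e6 a, e6 b] * nuWedgeOmega ν (e6 j) (e6 c) (e6 d)
    + nuWedgeOmega ν (e6 i) (e6 a) (e6 b) * φ ![e6 j, e6 c, e6 d]]
  simp only [mul_add, Finset.sum_add_distrib]
  rw [hswap fun a b c d => nuWedgeOmega ν (e6 i) (e6 a) (e6 b) * φ ![e6 j, e6 c, e6 d]]
  simp only [mul_comm (nuWedgeOmega _ _ _ _)]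
  rw [contraction_eq φ hprim, contraction_eq φ hprim]
  simp only [alternating_swap_left φ (e6 i) (e6 j), mul_neg, Finset.sum_neg_distrib,
    add_neg_cancel]
end
end
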